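/- For every n ≥ r ≥ 1 and every non-decreasing function f : ℕ → ℝ, there exists a complete multipartite graph G on n vertices with at most r parts such that e_f(G) = ex_f(n, K_{r+1}); that is, the maximum of Σ_v f(d_G(v)) over all K_{r+1}-free graphs on n vertices is attained by some complete r-partite graph. -/

import Mathlib

open Finset
open scoped Classical

/-- `e_f(G) = Σ_v f(deg_G(v))` for a function `f : ℕ → ℝ`. -/
noncomputable def eF {V : Type*} [Fintype V] (G : SimpleGraph V) (f : ℕ → ℝ) : ℝ :=
  ∑ v, f (G.degree v)

/-- The **Erdős degree majorization theorem**, relative to a vertex set `S`: if `G` has no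
`(r + 1)`-clique in `S`, then some complete `r`-partite graph on `S` has pointwise at least the
degrees of `G`. -/
theorem SimpleGraph.CliqueFreeOn.exists_coloring_degree_le {V : Type*} (G : SimpleGraph V)
    (r : ℕ) (S : Finset V) (hS : G.CliqueFreeOn S (r + 1)) :
    ∃ c : V → ℕ, (∀ v ∈ S, c v < r) ∧
      ∀ v ∈ S, #{w ∈ S | G.Adj v w} ≤ #{w ∈ S | c v ≠ c w} := by
  induction r generalizing S with
  | zero =>
    have hempty : ∀ v, v ∉ S := fun v hv =>
      hS (t := {v}) (by simpa using hv) (by simp [SimpleGraph.isNClique_iff])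
    exact ⟨fun _ => 0, fun v hv => absurd hv (hempty v), fun v hv => absurd hv (hempty v)⟩
  | succ r ih =>
    rcases S.eq_empty_or_nonempty with rfl | hne
    · exact ⟨fun _ => 0, by simp, by simp⟩
    obtain ⟨v, hv, hmax⟩ := S.exists_max_image (fun v => #{w ∈ S | G.Adj v w}) hne
    set T := {w ∈ S | G.Adj v w} with hT
    have hTS : T ⊆ S := filter_subset _ _
    have hTfree : G.CliqueFreeOn T (r + 1) := by
      refine SimpleGraph.CliqueFreeOn.subset G (fun w hw => ?_)
        (SimpleGraph.CliqueFreeOn.of_succ G hS (mem_coe.2 hv))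
      simpa [hT] using hw
    obtain ⟨c, hc, hdeg⟩ := ih T hTfree
    refine ⟨fun w => if w ∈ T then c w else r, fun w _ => ?_, fun w hw => ?_⟩
    · by_cases hwT : w ∈ T
      · simpa [hwT] using (hc w hwT).trans (Nat.lt_succ_self r)
      · simp [hwT]
    by_cases hwT : w ∈ T
    · calc #{u ∈ S | G.Adj w u}
          ≤ #({u ∈ T | G.Adj w u} ∪ (S \ T)) := card_le_card fun u hu => by
            simp only [mem_union, mem_sdiff, mem_filter] at hu ⊢
            tauto
        _ ≤ #{u ∈ T | G.Adj w u} + #(S \ T) := card_union_le _ _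
        _ ≤ #{u ∈ T | c w ≠ c u} + #(S \ T) := Nat.add_le_add_right (hdeg w hwT) _
        _ = #({u ∈ T | c w ≠ c u} ∪ (S \ T)) := (card_union_of_disjoint
            (disjoint_sdiff.mono_left (filter_subset _ _))).symm
        _ ≤ _ := card_le_card fun u hu => by
            simp only [mem_union, mem_sdiff, mem_filter] at hu ⊢
            rcases hu with ⟨huT, hu⟩ | ⟨huS, huT⟩
            · exact ⟨hTS huT, by simpa [hwT, huT] using hu⟩
            · exact ⟨huS, by simpa [hwT, huT] using (hc w hwT).ne⟩
    · refine (hmax w hw).trans (card_le_card fun u huT => ?_)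
      exact mem_filter.2 ⟨hTS huT, by simpa [hwT, huT] using (hc u huT).ne'⟩

/-- The **Erdős degree majorization theorem**: the degrees of a `K_{r+1}`-free graph are
bounded pointwise by those of a complete `r`-partite graph on the same vertices. -/
theorem SimpleGraph.CliqueFree.exists_comap_top_degree_le {V : Type*} [Fintype V]
    {G : SimpleGraph V} {r : ℕ} (hG : G.CliqueFree (r + 1)) :
    ∃ g : V → Fin r, ∀ v, G.degree v ≤ ((⊤ : SimpleGraph (Fin r)).comap g).degree v := by
  obtain ⟨c, hc, hdeg⟩ :=
    SimpleGraph.CliqueFreeOn.exists_coloring_degree_le G r univ hG.cliqueFreeOn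
  refine ⟨fun v => ⟨c v, hc v (mem_univ v)⟩, fun v => ?_⟩
  simpa [← SimpleGraph.card_neighborFinset_eq_degree, SimpleGraph.neighborFinset_eq_filter]
    using hdeg v (mem_univ v)

/-- For every `n ≥ r ≥ 1` and every non-decreasing `f : ℕ → ℝ`, the maximum of
`Σ_v f(deg v)` over all `K_{r+1}`-free graphs on `n` vertices is attained by a complete
multipartite graph with at most `r` parts. -/
theorem ex_f_attained_by_complete_multipartite (n r : ℕ) (hrn : r ≤ n) (hr : 1 ≤ r)
    (f : ℕ → ℝ) (hf : Monotone f) :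
    ∃ g : Fin n → Fin r,
      IsGreatest {m : ℝ | ∃ G : SimpleGraph (Fin n), G.CliqueFree (r + 1) ∧ eF G f = m}
        (eF ((⊤ : SimpleGraph (Fin r)).comap g) f) := by
  have : Nonempty (Fin r) := ⟨⟨0, hr⟩⟩
  obtain ⟨g, hg⟩ := Finite.exists_max
    fun g : Fin n → Fin r => eF ((⊤ : SimpleGraph (Fin r)).comap g) f
  refine ⟨g, ⟨_, ?_, rfl⟩, ?_⟩
  · have hcol : ((⊤ : SimpleGraph (Fin r)).comap g).Colorable r :=
      ⟨SimpleGraph.Coloring.mk g fun h => h⟩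
    exact hcol.cliqueFree (Nat.lt_succ_self r)
  · rintro _ ⟨G, hG, rfl⟩
    obtain ⟨g', hg'⟩ := hG.exists_comap_top_degree_le
    refine le_trans (sum_le_sum fun v _ => hf ?_) (hg g')
    exact (hg' v).trans_eq (by congr!)
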